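/- (Lemma 2.2 of the paper, value estimate) Let R > 0 and let x, z ∈ ℝ² with |x| < R, |z| < R, x₂ ≠ 0, z₂ ≠ 0 and x ≠ z. Let G(·,x), G(·,z) : ℝ² → ℂ be C¹ in a neighborhood of ∂B_R and assume: (HK) ∫_{∂B_R} ( conj(G(ξ,x)) ∂_νG(ξ,z) − conj(∂_νG(ξ,x)) G(ξ,z) ) ds(ξ) = 2i · Im G(x,z); and there is a constant C₀ > 0 such that for all ξ ∈ ∂B_R and y ∈ {x, z}: |G(ξ,y)| ≤ C₀ R^{−1/2} and |∂_νG(ξ,y) − i κ₀(ξ) G(ξ,y)| ≤ C₀ R^{−3/2}. Then | ∫_{∂B_R} κ₀(ξ) conj(G(ξ,x)) G(ξ,z) ds(ξ) − Im G(x,z) | ≤ 2π C₀² R^{−1}. -/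

import Mathlib

noncomputable section
open MeasureTheory Real Filter Topology

/-- Points of the plane ℝ². -/
abbrev Pt : Type := EuclideanSpace ℝ (Fin 2)

/-- The point with coordinates (a, b). -/
def pt (a b : ℝ) : Pt := (WithLp.equiv 2 (Fin 2 → ℝ)).symm ![a, b]

/-- The point ρ·(cos θ, sin θ) on the circle of radius ρ. -/
def ptc (ρ θ : ℝ) : Pt := pt (ρ * Real.cos θ) (ρ * Real.sin θ)

/-- The Laplacian of a complex-valued function on ℝ². -/
def lap (u : Pt → ℂ) (x : Pt) : ℂ :=
  fderiv ℝ (fun y => fderiv ℝ u y (pt 1 0)) x (pt 1 0) +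
  fderiv ℝ (fun y => fderiv ℝ u y (pt 0 1)) x (pt 0 1)

/-- Radial (outward normal) derivative on a circle centered at the origin: ∇F(ξ)·(ξ/|ξ|). -/
def dnu (F : Pt → ℂ) (ξ : Pt) : ℂ := fderiv ℝ F ξ ((‖ξ‖⁻¹ : ℝ) • ξ)

/-- Integral over the circle ∂B_ρ: ∫₀^{2π} F(ρ cos θ, ρ sin θ) ρ dθ (complex valued). -/
def circInt (ρ : ℝ) (F : Pt → ℂ) : ℂ := ∫ θ in (0:ℝ)..(2 * π), F (ptc ρ θ) * (ρ : ℂ)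

/-- Integral over the circle ∂B_ρ: ∫₀^{2π} F(ρ cos θ, ρ sin θ) ρ dθ (real valued). -/
def circIntR (ρ : ℝ) (F : Pt → ℝ) : ℝ := ∫ θ in (0:ℝ)..(2 * π), F (ptc ρ θ) * ρ

/-- The background two-layer wavenumber κ₀ : equal to κ₁ on {x₂ > 0} and κ₂ on {x₂ ≤ 0}. -/
def kappa0 (κ1 κ2 : ℝ) (x : Pt) : ℝ := if 0 < x 1 then κ1 else κ2

lemma norm_ptc (ρ θ : ℝ) : ‖ptc ρ θ‖ = |ρ| := by
  rw [EuclideanSpace.norm_eq, ← Real.sqrt_sq_eq_abs]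
  congr 1
  simp only [ptc, pt, WithLp.equiv_symm_apply, Fin.sum_univ_two, Real.norm_eq_abs, sq_abs,
    Matrix.cons_val_zero, Matrix.cons_val_one]
  linear_combination ρ ^ 2 * Real.sin_sq_add_cos_sq θ

lemma continuous_ptc (ρ : ℝ) : Continuous (ptc ρ) := by
  refine (PiLp.continuous_toLp 2 (fun _ : Fin 2 => ℝ)).comp (continuous_pi fun i => ?_)
  fin_cases i
  · exact continuous_const.mul Real.continuous_cos
  · exact continuous_const.mul Real.continuous_sin

lemma measurable_kappa0 (κ1 κ2 : ℝ) : Measurable (kappa0 κ1 κ2) := by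
  refine Measurable.ite (measurableSet_lt measurable_const ?_) measurable_const measurable_const
  exact (EuclideanSpace.proj (𝕜 := ℝ) (1 : Fin 2)).continuous.measurable

lemma abs_kappa0_le (κ1 κ2 : ℝ) (x : Pt) : |kappa0 κ1 κ2 x| ≤ max |κ1| |κ2| := by
  unfold kappa0
  split_ifs
  · exact le_max_left _ _
  · exact le_max_right _ _

/-- The normal derivative of a `C¹` function is continuous away from the origin. -/
lemma ContDiffOn.continuousOn_dnu {F : Pt → ℂ} {U : Set Pt} (hU : IsOpen U)
    (hF : ContDiffOn ℝ 1 F U) : ContinuousOn (dnu F) (U \ {0}) := by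
  refine ((hF.continuousOn_fderiv_of_isOpen hU le_rfl).mono Set.sdiff_subset).clm_apply ?_
  exact (continuousOn_id.norm.inv₀ fun ξ hξ => norm_ne_zero_iff.2 hξ.2).smul continuousOn_id

/-- Lemma 2.2, value estimate: assuming the Helmholtz–Kirchhoff identity and the
decay bounds on ∂B_R, | ∫_{∂B_R} κ₀ conj(G(·,x)) G(·,z) ds − Im G(x,z) | ≤ 2π C₀² R⁻¹. -/
theorem lemma22_value_estimate
    (κ1 κ2 : ℝ) (hκ1 : 0 < κ1) (hκ2 : 0 < κ2)
    (R : ℝ) (hR : 0 < R) (x z : Pt) (hxR : ‖x‖ < R) (hzR : ‖z‖ < R)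
    (hx2 : x 1 ≠ 0) (hz2 : z 1 ≠ 0) (hxz : x ≠ z)
    (G : Pt → Pt → ℂ)
    (U : Set Pt) (hU : IsOpen U) (hUsph : Metric.sphere (0:Pt) R ⊆ U)
    (hGx : ContDiffOn ℝ 1 (fun ξ => G ξ x) U) (hGz : ContDiffOn ℝ 1 (fun ξ => G ξ z) U)
    (hHK : circInt R (fun ξ =>
        (starRingEnd ℂ) (G ξ x) * dnu (fun ξ' => G ξ' z) ξ
          - (starRingEnd ℂ) (dnu (fun ξ' => G ξ' x) ξ) * G ξ z)
      = 2 * Complex.I * (((G x z).im : ℝ) : ℂ))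
    (C₀ : ℝ) (hC₀ : 0 < C₀)
    (hbound : ∀ ξ ∈ Metric.sphere (0:Pt) R, ∀ y ∈ ({x, z} : Set Pt),
      ‖G ξ y‖ ≤ C₀ * R ^ (-(1/2) : ℝ) ∧
      ‖dnu (fun ξ' => G ξ' y) ξ - Complex.I * ((kappa0 κ1 κ2 ξ : ℝ) : ℂ) * G ξ y‖
        ≤ C₀ * R ^ (-(3/2) : ℝ)) :
    ‖circInt R (fun ξ => ((kappa0 κ1 κ2 ξ : ℝ) : ℂ) * (starRingEnd ℂ) (G ξ x) * G ξ z)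
        - (((G x z).im : ℝ) : ℂ)‖ ≤ 2 * π * C₀ ^ 2 / R := by
  set Gx : Pt → ℂ := fun ξ => G ξ x
  set Gz : Pt → ℂ := fun ξ => G ξ z
  have hsph (θ : ℝ) : ptc R θ ∈ Metric.sphere (0 : Pt) R := by
    rw [mem_sphere_zero_iff_norm, norm_ptc, abs_of_pos hR]
  have hmem (θ : ℝ) : ptc R θ ∈ U \ {0} :=
    ⟨hUsph (hsph θ), by
      rw [Set.mem_singleton_iff, ← norm_eq_zero, norm_ptc, abs_of_pos hR]; exact hR.ne'⟩
  have hcx : Continuous fun θ => Gx (ptc R θ) :=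
    hGx.continuousOn.comp_continuous (continuous_ptc R) fun θ => (hmem θ).1
  have hcz : Continuous fun θ => Gz (ptc R θ) :=
    hGz.continuousOn.comp_continuous (continuous_ptc R) fun θ => (hmem θ).1
  have hdx : Continuous fun θ => dnu Gx (ptc R θ) :=
    (hGx.continuousOn_dnu hU).comp_continuous (continuous_ptc R) hmem
  have hdz : Continuous fun θ => dnu Gz (ptc R θ) :=
    (hGz.continuousOn_dnu hU).comp_continuous (continuous_ptc R) hmem
  have hflux : IntervalIntegrable (fun θ => ((starRingEnd ℂ) (Gx (ptc R θ)) * dnu Gz (ptc R θ)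
      - (starRingEnd ℂ) (dnu Gx (ptc R θ)) * Gz (ptc R θ)) * (R : ℂ)) volume 0 (2 * π) := by
    refine Continuous.intervalIntegrable ?_ _ _
    exact (((Complex.continuous_conj.comp hcx).mul hdz).sub
      ((Complex.continuous_conj.comp hdx).mul hcz)).mul continuous_const
  have hkappa : IntervalIntegrable (fun θ => ((kappa0 κ1 κ2 (ptc R θ) : ℝ) : ℂ))
      volume 0 (2 * π) := by
    refine (intervalIntegrable_const (c := max |κ1| |κ2|)).mono_fun
      (Complex.measurable_ofReal.comp
        ((measurable_kappa0 κ1 κ2).comp (continuous_ptc R).measurable)).aestronglyMeasurable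
      (Eventually.of_forall fun θ => ?_)
    simpa using (abs_kappa0_le κ1 κ2 (ptc R θ)).trans (le_abs_self _)
  have hprod : IntervalIntegrable (fun θ => ((kappa0 κ1 κ2 (ptc R θ) : ℝ) : ℂ)
      * (starRingEnd ℂ) (Gx (ptc R θ)) * Gz (ptc R θ) * (R : ℂ)) volume 0 (2 * π) :=
    ((hkappa.mul_continuousOn (Complex.continuous_conj.comp hcx).continuousOn).mul_continuousOn
      hcz.continuousOn).mul_const _
  have hpow : R ^ (-(1/2) : ℝ) * R ^ (-(3/2) : ℝ) * R = R⁻¹ := by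
    rw [← Real.rpow_add hR, ← Real.rpow_add_one hR.ne', ← Real.rpow_neg_one]
    norm_num
  have hdiff : 2 * Complex.I * (circInt R (fun ξ => ((kappa0 κ1 κ2 ξ : ℝ) : ℂ)
        * (starRingEnd ℂ) (Gx ξ) * Gz ξ) - (((G x z).im : ℝ) : ℂ))
      = ∫ θ in (0:ℝ)..(2 * π), (2 * Complex.I * (((kappa0 κ1 κ2 (ptc R θ) : ℝ) : ℂ)
          * (starRingEnd ℂ) (Gx (ptc R θ)) * Gz (ptc R θ) * (R : ℂ))
        - ((starRingEnd ℂ) (Gx (ptc R θ)) * dnu Gz (ptc R θ)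
          - (starRingEnd ℂ) (dnu Gx (ptc R θ)) * Gz (ptc R θ)) * (R : ℂ)) := by
    rw [mul_sub, ← hHK, intervalIntegral.integral_sub (hprod.const_mul _) hflux,
      intervalIntegral.integral_const_mul]
    rfl
  have hle : ‖2 * Complex.I * (circInt R (fun ξ => ((kappa0 κ1 κ2 ξ : ℝ) : ℂ)
        * (starRingEnd ℂ) (Gx ξ) * Gz ξ) - (((G x z).im : ℝ) : ℂ))‖
      ≤ 2 * C₀ ^ 2 * R⁻¹ * |2 * π - 0| := by
    rw [hdiff]
    refine intervalIntegral.norm_integral_le_of_norm_le_const fun θ _ => ?_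
    obtain ⟨hx, hx'⟩ := hbound _ (hsph θ) x (by simp)
    obtain ⟨hz, hz'⟩ := hbound _ (hsph θ) z (by simp)
    set k : ℂ := ((kappa0 κ1 κ2 (ptc R θ) : ℝ) : ℂ) with hk
    set a := Gx (ptc R θ)
    set b := Gz (ptc R θ)
    set a' := dnu Gx (ptc R θ)
    set b' := dnu Gz (ptc R θ)
    have hsplit : 2 * Complex.I * (k * (starRingEnd ℂ) a * b * (R : ℂ))
        - ((starRingEnd ℂ) a * b' - (starRingEnd ℂ) a' * b) * (R : ℂ)
        = ((starRingEnd ℂ) (a' - Complex.I * k * a) * b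
          - (starRingEnd ℂ) a * (b' - Complex.I * k * b)) * (R : ℂ) := by
      have hkc : (starRingEnd ℂ) k = k := Complex.conj_ofReal _
      simp only [map_sub, map_mul, Complex.conj_I, hkc]
      ring
    rw [hsplit, norm_mul, Complex.norm_real, Real.norm_of_nonneg hR.le]
    calc _ ≤ (C₀ * R ^ (-(3/2) : ℝ) * (C₀ * R ^ (-(1/2) : ℝ))
          + C₀ * R ^ (-(1/2) : ℝ) * (C₀ * R ^ (-(3/2) : ℝ))) * R := by
          refine mul_le_mul_of_nonneg_right ((norm_sub_le _ _).trans ?_) hR.le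
          rw [norm_mul, norm_mul, RCLike.norm_conj, RCLike.norm_conj]
          gcongr
      _ = 2 * C₀ ^ 2 * R⁻¹ := by rw [← hpow]; ring
  rw [norm_mul, norm_mul, Complex.norm_I, Complex.norm_ofNat, sub_zero,
    abs_of_pos Real.two_pi_pos] at hle
  rw [div_eq_mul_inv]
  linarith

end
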